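/- arXiv:1810.04224 — 2 statements merged into one kernel-verified Lean document; each statement's English description precedes it below -/
import Mathlib

section
/- Let p > 1, ω ∈ ℝ, and let φ : ℝ → ℝ be four times continuously differentiable, with constants C > 0 and κ > 0 such that |φ^{(k)}(x)| ≤ C e^{−κ|x|} for all x ∈ ℝ and all k = 0,1,2,3,4. Suppose φ satisfies the profile equation φ''''(x) + ω φ''(x) + φ(x) + p·sign(φ'(x)) |φ'(x)|^{p−1} φ''(x) = 0 for all x ∈ ℝ (i.e. φ'''' + ωφ'' + φ + ∂_x(|φ'|^{p}) = 0). Then: ∫_ℝ φ''(x)² dx = ∫_ℝ φ(x)² dx + ((p−1)/(2(p+1))) ∫_ℝ |φ'(x)|^{p} φ'(x) dx, and ω ∫_ℝ φ'(x)² dx = 2 ∫_ℝ φ(x)² dx − ((p+3)/(2(p+1))) ∫_ℝ |φ'(x)|^{p} φ'(x) dx. -/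
open MeasureTheory

theorem hasDerivAt_abs_rpow_sign {p : ℝ} (hp : 1 < p) (y : ℝ) :
    HasDerivAt (fun t : ℝ => |t| ^ p) (p * Real.sign y * |y| ^ (p - 1)) y := by
  convert hasDerivAt_abs_rpow y hp using 1
  rcases lt_trichotomy y 0 with hy | rfl | hy
  · rw [Real.sign_of_neg hy, show p - 1 = p - 2 + 1 by ring,
      Real.rpow_add_one (abs_pos.2 hy.ne).ne', abs_of_neg hy]
    ring
  · simp
  · rw [Real.sign_of_pos hy, show p - 1 = p - 2 + 1 by ring,
      Real.rpow_add_one (abs_pos.2 hy.ne').ne', abs_of_pos hy]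
    ring

theorem sign_mul_abs_rpow_sub_one_mul_self {p : ℝ} (hp : p ≠ 0) (y : ℝ) :
    Real.sign y * |y| ^ (p - 1) * y = |y| ^ p := by
  rcases eq_or_ne y 0 with rfl | hy
  · simp [Real.zero_rpow hp]
  · have h : Real.sign y * y = |y| := by
      rcases hy.lt_or_gt with hy | hy
      · rw [Real.sign_of_neg hy, abs_of_neg hy]; ring
      · rw [Real.sign_of_pos hy, abs_of_pos hy]; ring
    rw [mul_right_comm, h, mul_comm, Real.rpow_sub_one (abs_pos.2 hy).ne']
    field_simp

theorem integrable_exp_neg_mul_abs {κ : ℝ} (hκ : 0 < κ) :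
    Integrable (fun x : ℝ => Real.exp (-κ * |x|)) := by
  rw [← integrableOn_univ, ← Set.Iic_union_Ioi (a := (0 : ℝ))]
  refine IntegrableOn.union ?_ ?_
  · refine (integrableOn_exp_mul_Iic hκ 0).congr_fun (fun x hx => ?_) measurableSet_Iic
    simp [abs_of_nonpos (Set.mem_Iic.1 hx)]
  · refine (integrableOn_exp_mul_Ioi (neg_lt_zero.2 hκ) 0).congr_fun (fun x hx => ?_)
      measurableSet_Ioi
    simp [abs_of_pos (Set.mem_Ioi.1 hx)]

/-- Pohozaev identities for `a'''' + ω a'' + a + ∂_x(|a'|^p) = 0`, where `b`, `c`, `d`, `e` are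
the successive derivatives of `a`. -/
theorem pohozaev_identities_of_hasDerivAt {p ω C : ℝ} (hp : 1 < p) {a b c d e : ℝ → ℝ}
    (ha : ∀ x, HasDerivAt a (b x) x) (hb : ∀ x, HasDerivAt b (c x) x)
    (hc : ∀ x, HasDerivAt c (d x) x) (hd : ∀ x, HasDerivAt d (e x) x)
    (ia : Integrable a) (ib : Integrable b) (ic : Integrable c) (id : Integrable d)
    (ba : ∀ x, |a x| ≤ C) (bb : ∀ x, |b x| ≤ C) (bc : ∀ x, |c x| ≤ C)
    (heq : ∀ x, e x + ω * c x + a x + p * Real.sign (b x) * |b x| ^ (p - 1) * c x = 0) :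
    (∫ x, c x ^ 2)
      = (∫ x, a x ^ 2) + ((p - 1) / (2 * (p + 1))) * ∫ x, |b x| ^ p * b x ∧
    ω * (∫ x, b x ^ 2)
      = 2 * (∫ x, a x ^ 2) - ((p + 3) / (2 * (p + 1))) * ∫ x, |b x| ^ p * b x := by
  have hN (x : ℝ) : HasDerivAt (fun t => |b t| ^ p)
      (p * Real.sign (b x) * |b x| ^ (p - 1) * c x) x :=
    (hasDerivAt_abs_rpow_sign hp (b x)).comp x (hb x)
  have bN (x : ℝ) : ‖|b x| ^ p‖ ≤ C ^ p := by
    rw [Real.norm_of_nonneg (by positivity)]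
    exact Real.rpow_le_rpow (abs_nonneg _) (bb x) (by linarith)
  have hcont {f g : ℝ → ℝ} (h : ∀ x, HasDerivAt f (g x) x) : Continuous f :=
    continuous_iff_continuousAt.2 fun x => (h x).continuousAt
  have imul {f g g' : ℝ → ℝ} {K : ℝ} (hf : Integrable f) (hg : ∀ x, HasDerivAt g (g' x) x)
      (bg : ∀ x, ‖g x‖ ≤ K) : Integrable (fun x => g x * f x) :=
    hf.bdd_mul (hcont hg).aestronglyMeasurable (Filter.Eventually.of_forall bg)
  have iaa : Integrable (fun x => a x ^ 2) := by simpa only [sq] using imul ia ha ba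
  have ibb : Integrable (fun x => b x ^ 2) := by simpa only [sq] using imul ib hb bb
  have icc : Integrable (fun x => c x ^ 2) := by simpa only [sq] using imul ic hc bc
  have iNb : Integrable (fun x => |b x| ^ p * b x) := imul ib hN bN
  have iNa : Integrable (fun x => |b x| ^ p * a x) := imul ia hN bN
  have iad : Integrable (fun x => a x * d x) := imul id ha ba
  have ibd : Integrable (fun x => b x * d x) := imul id hb bb
  have ibc : Integrable (fun x => b x * c x) := imul ic hb bb
  have iab : Integrable (fun x => a x * b x) := imul ib ha ba
  have hp1 : p + 1 ≠ 0 := by linarith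
  have hfirst_integral (x : ℝ) : b x * d x - c x ^ 2 / 2 + ω * (b x ^ 2 / 2) + a x ^ 2 / 2
      + p / (p + 1) * (|b x| ^ p * b x) = 0 := by
    set G : ℝ → ℝ := fun x => b x * d x - c x ^ 2 / 2 + ω * (b x ^ 2 / 2) + a x ^ 2 / 2
      + p / (p + 1) * (|b x| ^ p * b x)
    have hG' (x : ℝ) : HasDerivAt G 0 x := by
      have h := ((((hb x).mul (hd x)).sub (((hc x).pow 2).div_const 2)).add
        ((((hb x).pow 2).div_const 2).const_mul ω)).add (((ha x).pow 2).div_const 2) |>.add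
        (((hN x).mul (hb x)).const_mul (p / (p + 1)))
      refine h.congr_deriv ?_
      have hs := sign_mul_abs_rpow_sub_one_mul_self (p := p) (by linarith) (b x)
      have he := heq x
      push_cast
      rw [← hs]
      field_simp
      linear_combination b x * he
    have hconst (y : ℝ) : G y = G x :=
      is_const_of_deriv_eq_zero (fun z => (hG' z).differentiableAt) (fun z => (hG' z).deriv) y x
    have hint : Integrable G :=
      (((ibd.sub (icc.div_const 2)).add ((ibb.div_const 2).const_mul ω)).add
        (iaa.div_const 2)).add (iNb.const_mul (p / (p + 1)))
    rw [show G = fun _ => G x from funext hconst, integrable_const_iff] at hint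
    rcases hint with h | h
    · exact h
    · exact absurd h.measure_univ_lt_top (by simp)
  have hbc : ∫ x, (c x ^ 2 + b x * d x) = 0 :=
    integral_eq_zero_of_hasDerivAt_of_integrable (f := fun x => b x * c x)
      (fun x => ((hb x).mul (hc x)).congr_deriv (by ring)) (icc.add ibd) ibc
  have hlin (α β γ δ : ℝ) :
      ∫ x, (α * a x ^ 2 + β * b x ^ 2 + γ * c x ^ 2 + δ * (|b x| ^ p * b x))
        = α * (∫ x, a x ^ 2) + β * (∫ x, b x ^ 2) + γ * (∫ x, c x ^ 2)
          + δ * ∫ x, |b x| ^ p * b x := by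
    have hab : Integrable (fun x => α * a x ^ 2 + β * b x ^ 2) :=
      (iaa.const_mul α).add (ibb.const_mul β)
    have habc : Integrable (fun x => α * a x ^ 2 + β * b x ^ 2 + γ * c x ^ 2) :=
      hab.add (icc.const_mul γ)
    rw [integral_add habc (iNb.const_mul δ), integral_add hab (icc.const_mul γ),
      integral_add (iaa.const_mul α) (ibb.const_mul β)]
    simp only [integral_const_mul]
  have hvirial : ∫ x, (-(1 / 2) * a x ^ 2 + -(ω / 2) * b x ^ 2 + 3 / 2 * c x ^ 2
      + -(p / (p + 1)) * (|b x| ^ p * b x)) = 0 := by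
    rw [← hbc]
    refine integral_congr_ae (Filter.Eventually.of_forall fun x => ?_)
    linear_combination -hfirst_integral x
  have henergy : ∫ x, (-1 * a x ^ 2 + ω * b x ^ 2 + -1 * c x ^ 2 + 1 * (|b x| ^ p * b x))
      = 0 := by
    refine integral_eq_zero_of_hasDerivAt_of_integrable
      (f := fun x => a x * d x - b x * c x + ω * (a x * b x) + |b x| ^ p * a x) (fun x => ?_)
      ((((iaa.const_mul _).add (ibb.const_mul ω)).add (icc.const_mul _)).add (iNb.const_mul _))
      (((iad.sub ibc).add (iab.const_mul ω)).add iNa)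
    refine (((((ha x).mul (hd x)).sub ((hb x).mul (hc x))).add
      (((ha x).mul (hb x)).const_mul ω)).add ((hN x).mul (ha x))).congr_deriv ?_
    linear_combination a x * heq x
  rw [hlin] at hvirial henergy
  field_simp at hvirial ⊢
  constructor
  · linear_combination hvirial + (p + 1) * henergy
  · linear_combination hvirial + 3 * (p + 1) * henergy

/-- Pohozaev identities for solutions of `φ'''' + ωφ'' + φ + ∂_x(|φ'|^{p}) = 0`. -/
theorem pohozaev_identities_absolute_nonlinearity (p ω : ℝ) (hp : 1 < p)
    (φ : ℝ → ℝ) (hφ : ContDiff ℝ 4 φ) (C κ : ℝ) (hC : 0 < C) (hκ : 0 < κ)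
    (hdecay : ∀ k ≤ 4, ∀ x : ℝ, |iteratedDeriv k φ x| ≤ C * Real.exp (-κ * |x|))
    (heq : ∀ x : ℝ, iteratedDeriv 4 φ x + ω * iteratedDeriv 2 φ x + φ x
      + p * Real.sign (deriv φ x) * |deriv φ x| ^ (p - 1) * iteratedDeriv 2 φ x = 0) :
    (∫ x : ℝ, (iteratedDeriv 2 φ x) ^ 2)
      = (∫ x : ℝ, (φ x) ^ 2)
        + ((p - 1) / (2 * (p + 1))) * ∫ x : ℝ, |deriv φ x| ^ p * deriv φ x ∧
    ω * (∫ x : ℝ, (deriv φ x) ^ 2)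
      = 2 * (∫ x : ℝ, (φ x) ^ 2)
        - ((p + 3) / (2 * (p + 1))) * ∫ x : ℝ, |deriv φ x| ^ p * deriv φ x := by
  have hD (k : ℕ) (hk : k < 4) (x : ℝ) :
      HasDerivAt (iteratedDeriv k φ) (iteratedDeriv (k + 1) φ x) x := by
    rw [iteratedDeriv_succ]
    exact (hφ.differentiable_iteratedDeriv k (by exact_mod_cast hk) x).hasDerivAt
  have hI (k : ℕ) (hk : k < 4) : Integrable (iteratedDeriv k φ) :=
    ((integrable_exp_neg_mul_abs hκ).const_mul C).mono'
      (hφ.continuous_iteratedDeriv k (by exact_mod_cast hk.le)).aestronglyMeasurable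
      (Filter.Eventually.of_forall (hdecay k hk.le))
  have hB (k : ℕ) (hk : k < 4) (x : ℝ) : |iteratedDeriv k φ x| ≤ C :=
    (hdecay k hk.le x).trans (mul_le_of_le_one_right hC.le
      (Real.exp_le_one_iff.2 (mul_nonpos_of_nonpos_of_nonneg (by linarith) (abs_nonneg x))))
  have h := pohozaev_identities_of_hasDerivAt (ω := ω) hp
    (hD 0 (by norm_num)) (hD 1 (by norm_num)) (hD 2 (by norm_num)) (hD 3 (by norm_num))
    (hI 0 (by norm_num)) (hI 1 (by norm_num)) (hI 2 (by norm_num)) (hI 3 (by norm_num))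
    (hB 0 (by norm_num)) (hB 1 (by norm_num)) (hB 2 (by norm_num))
    (by simpa only [iteratedDeriv_zero, iteratedDeriv_one, zero_add] using heq)
  simpa only [iteratedDeriv_zero, iteratedDeriv_one, zero_add, Nat.reduceAdd] using h
end

section
/- Let 1 < p < 3 and define m_I(λ) := inf{ I[u] : u a real Schwartz function with ∫_ℝ u'(x)² dx = λ } for λ > 0 (a real number, since I is bounded below on this constraint set). Then for all 0 < α < λ one has the strict scaling inequality m_I(λ) < (λ/α)·m_I(α); in particular the function λ ↦ m_I(λ)/λ is strictly decreasing on (0,∞), and the strict sub-additivity m_I(λ) < m_I(α) + m_I(λ−α) holds for all 0 < α < λ. -/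
open MeasureTheory

/-- The functional `I[u] = (1/2)∫ (u''² + u²) - (1/(p+1)) ∫ |u'|^p u'`. -/
noncomputable def Ifun (p : ℝ) (u : ℝ → ℝ) : ℝ :=
  (1 / 2) * (∫ x : ℝ, ((deriv (deriv u) x) ^ 2 + (u x) ^ 2))
    - (1 / (p + 1)) * ∫ x : ℝ, |deriv u x| ^ p * deriv u x

/-- The cost function `m_I(λ)`: the infimum of `I` over Schwartz functions with
`∫ u'² = λ`. -/
noncomputable def mI (p lam : ℝ) : ℝ :=
  sInf {r : ℝ | ∃ u : SchwartzMap ℝ ℝ, (∫ x : ℝ, (deriv u x) ^ 2) = lam ∧ Ifun p u = r}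

open scoped SchwartzMap

namespace SchwartzMap

theorem coe_derivCLM_real (u : 𝓢(ℝ, ℝ)) : ⇑(derivCLM ℝ ℝ u) = deriv u :=
  funext fun x => derivCLM_apply ℝ u x

theorem integrable_mul_real (f g : 𝓢(ℝ, ℝ)) : Integrable (fun x => f x * g x) :=
  (f.memLp 2).integrable_mul (g.memLp 2)

theorem integrable_sq_real (f : 𝓢(ℝ, ℝ)) : Integrable (fun x => f x ^ 2) := by
  simpa only [pow_two] using f.integrable_mul_real f

theorem integrable_abs_rpow_mul (f : 𝓢(ℝ, ℝ)) {p : ℝ} (hp : 0 ≤ p) :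
    Integrable (fun x => |f x| ^ p * f x) := by
  refine f.integrable.bdd_mul (c := (SchwartzMap.seminorm ℝ 0 0 f) ^ p) ?_ ?_
  · exact (f.continuous.abs.rpow_const fun _ => Or.inr hp).aestronglyMeasurable
  · refine Filter.Eventually.of_forall fun x => ?_
    rw [Real.norm_of_nonneg (by positivity)]
    exact Real.rpow_le_rpow (abs_nonneg _) (norm_le_seminorm ℝ f x) hp

/-- A one-dimensional Sobolev inequality. -/
theorem sq_le_integral_add (v : 𝓢(ℝ, ℝ)) (x : ℝ) :
    v x ^ 2 ≤ (∫ y, v y ^ 2) + ∫ y, deriv v y ^ 2 := by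
  have hv' := (derivCLM ℝ ℝ v).integrable_sq_real
  have hvv' := v.integrable_mul_real (derivCLM ℝ ℝ v)
  simp only [coe_derivCLM_real] at hv' hvv'
  have hlim : Filter.Tendsto (fun y => v y ^ 2) Filter.atBot (nhds 0) := by
    have := (v.tendsto_cocompact.mono_left atBot_le_cocompact).pow 2
    simpa using this
  have hftc := integral_Iic_of_hasDerivAt_of_tendsto' (a := x)
    (fun y _ => (v.hasDerivAt y).pow 2)
    (by simpa [mul_assoc] using (hvv'.const_mul 2).integrableOn) hlim
  rw [sub_zero] at hftc
  rw [← integral_add v.integrable_sq_real hv']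
  calc v x ^ 2 = _ := hftc.symm
    _ ≤ ∫ y in Set.Iic x, (v y ^ 2 + deriv v y ^ 2) := by
        refine integral_mono
          (by simpa [mul_assoc] using (hvv'.const_mul 2).restrict (s := Set.Iic x))
          (v.integrable_sq_real.add hv').integrableOn fun y => ?_
        simp only [Nat.cast_ofNat, Nat.add_one_sub_one, pow_one]
        nlinarith [sq_nonneg (v y - deriv v y)]
    _ ≤ _ := setIntegral_le_integral (v.integrable_sq_real.add hv')
        (Filter.Eventually.of_forall fun y => by positivity)

/-- `∫ (u''² + u²) = 2 ∫ u'² + ∫ (u'' + u)²`. -/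
theorem integral_sq_add_sq_eq (u : 𝓢(ℝ, ℝ)) :
    ∫ x, (deriv (deriv u) x ^ 2 + u x ^ 2)
      = 2 * (∫ x, deriv u x ^ 2) + ∫ x, (deriv (deriv u) x + u x) ^ 2 := by
  have h := integral_mul_deriv_eq_neg_deriv_mul u (derivCLM ℝ ℝ u)
  have h2 := (derivCLM ℝ ℝ (derivCLM ℝ ℝ u)).integrable_sq_real
  have h3 := u.integrable_mul_real (derivCLM ℝ ℝ (derivCLM ℝ ℝ u))
  simp only [coe_derivCLM_real] at h h2 h3
  have e : ∀ x, (deriv (deriv u) x + u x) ^ 2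
      = (deriv (deriv u) x ^ 2 + u x ^ 2) + 2 * (u x * deriv (deriv u) x) := fun x => by ring
  simp_rw [e]
  rw [integral_add (h2.fun_add u.integrable_sq_real) (h3.const_mul 2), integral_const_mul, h]
  simp only [pow_two]
  ring

end SchwartzMap

theorem Ifun_eq (p : ℝ) (u : 𝓢(ℝ, ℝ)) :
    Ifun p u = (∫ x, deriv u x ^ 2) + (1 / 2) * (∫ x, (deriv (deriv u) x + u x) ^ 2)
      - (1 / (p + 1)) * ∫ x, |deriv u x| ^ p * deriv u x := by
  rw [Ifun, u.integral_sq_add_sq_eq]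
  ring

theorem deriv_schwartz_smul (a : ℝ) (u : 𝓢(ℝ, ℝ)) : deriv (a • u : 𝓢(ℝ, ℝ)) = a • deriv u := by
  rw [← SchwartzMap.coe_derivCLM_real, ← SchwartzMap.coe_derivCLM_real, map_smul]
  rfl

theorem deriv_deriv_schwartz_smul (a : ℝ) (u : 𝓢(ℝ, ℝ)) :
    deriv (deriv (a • u : 𝓢(ℝ, ℝ))) = a • deriv (deriv u) := by
  rw [deriv_schwartz_smul, ← SchwartzMap.coe_derivCLM_real,
    ← deriv_schwartz_smul a (SchwartzMap.derivCLM ℝ ℝ u)]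
  rfl

theorem integral_deriv_smul_sq (a : ℝ) (u : 𝓢(ℝ, ℝ)) :
    ∫ x, deriv (a • u : 𝓢(ℝ, ℝ)) x ^ 2 = a ^ 2 * ∫ x, deriv u x ^ 2 := by
  rw [← integral_const_mul, deriv_schwartz_smul]
  simp [mul_pow]

theorem Ifun_smul {p a : ℝ} (ha : 0 < a) (u : 𝓢(ℝ, ℝ)) :
    Ifun p (a • u : 𝓢(ℝ, ℝ)) = a ^ 2 * ((∫ x, deriv u x ^ 2)
        + (1 / 2) * (∫ x, (deriv (deriv u) x + u x) ^ 2))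
      - a ^ (p + 1) * ((1 / (p + 1)) * ∫ x, |deriv u x| ^ p * deriv u x) := by
  have h1 : ∫ x, |deriv (a • u : 𝓢(ℝ, ℝ)) x| ^ p * deriv (a • u : 𝓢(ℝ, ℝ)) x
      = a ^ (p + 1) * ∫ x, |deriv u x| ^ p * deriv u x := by
    rw [← integral_const_mul, deriv_schwartz_smul]
    refine integral_congr_ae (Filter.Eventually.of_forall fun x => ?_)
    simp only [Pi.smul_apply, smul_eq_mul]
    rw [abs_mul, abs_of_pos ha, Real.mul_rpow ha.le (abs_nonneg _), Real.rpow_add_one ha.ne']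
    ring
  have h2 : ∫ x, (deriv (deriv (a • u : 𝓢(ℝ, ℝ))) x + (a • u : 𝓢(ℝ, ℝ)) x) ^ 2
      = a ^ 2 * ∫ x, (deriv (deriv u) x + u x) ^ 2 := by
    rw [← integral_const_mul, deriv_deriv_schwartz_smul]
    refine integral_congr_ae (Filter.Eventually.of_forall fun x => ?_)
    simp only [Pi.smul_apply, smul_eq_mul, smul_apply]
    ring
  rw [Ifun_eq, h1, h2, integral_deriv_smul_sq]
  ring

theorem bddBelow_Ifun {p : ℝ} (hp1 : 1 < p) (hp3 : p < 3) (lam : ℝ) :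
    BddBelow {r : ℝ | ∃ u : 𝓢(ℝ, ℝ), (∫ x : ℝ, (deriv u x) ^ 2) = lam ∧ Ifun p u = r} := by
  set s := (p - 1) / 2 with hs
  have hs0 : 0 < s := by rw [hs]; linarith
  have hs1 : s < 1 := by rw [hs]; linarith
  refine ⟨-(lam + lam ^ (1 / (1 - s))) / 2, ?_⟩
  rintro r ⟨u, hu, rfl⟩
  have hlam : 0 ≤ lam := hu ▸ integral_nonneg fun x => sq_nonneg _
  set v := SchwartzMap.derivCLM ℝ ℝ u with hv
  have hvu : ⇑v = deriv u := u.coe_derivCLM_real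
  set X := ∫ x, deriv v x ^ 2 with hX
  have hX0 : 0 ≤ X := integral_nonneg fun x => sq_nonneg _
  have hsup : ∀ x, v x ^ 2 ≤ lam + X := fun x => by
    simpa only [hvu, hu, hX] using v.sq_le_integral_add x
  have hpt : ∀ x, |v x| ^ p * v x ≤ (lam + X) ^ s * v x ^ 2 := fun x => by
    have h1 : |v x| ^ (p - 1) ≤ (lam + X) ^ s := by
      have := Real.rpow_le_rpow (sq_nonneg (v x)) (hsup x) hs0.le
      rwa [← sq_abs, ← Real.rpow_natCast, ← Real.rpow_mul (abs_nonneg _),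
        show ((2 : ℕ) : ℝ) * s = p - 1 by rw [hs]; push_cast; ring] at this
    calc |v x| ^ p * v x ≤ |v x| ^ p * |v x| := by gcongr; exact le_abs_self _
      _ = |v x| ^ (p - 1) * v x ^ 2 := by
          rcases eq_or_ne (v x) 0 with h | h
          · simp [h]
          · rw [← sq_abs, pow_two, ← mul_assoc, ← Real.rpow_add_one (abs_ne_zero.mpr h),
              ← Real.rpow_add_one (abs_ne_zero.mpr h), sub_add_cancel,
              Real.rpow_add_one (abs_ne_zero.mpr h)]
      _ ≤ _ := by gcongr
  have hN : ∫ x, |v x| ^ p * v x ≤ (lam + X) ^ s * lam := by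
    rw [← hu, ← hvu, ← integral_const_mul]
    refine integral_mono (v.integrable_abs_rpow_mul (by linarith))
      (v.integrable_sq_real.const_mul _) fun x => ?_
    simpa only [hvu, hu] using hpt x
  have hyoung := Real.geom_mean_le_arith_mean2_weighted hs0.le (sub_pos.2 hs1).le
    (add_nonneg hlam hX0) (Real.rpow_nonneg hlam (1 / (1 - s))) (by ring)
  rw [← Real.rpow_mul hlam, one_div_mul_cancel (sub_pos.2 hs1).ne', Real.rpow_one] at hyoung
  have hL := Real.rpow_nonneg hlam (1 / (1 - s))
  have hN2 : ∫ x, |v x| ^ p * v x ≤ (lam + X) + lam ^ (1 / (1 - s)) := by nlinarith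
  have hN3 : 1 / (p + 1) * (∫ x, |v x| ^ p * v x)
      ≤ 1 / 2 * ((lam + X) + lam ^ (1 / (1 - s))) := by
    calc _ ≤ 1 / (p + 1) * ((lam + X) + lam ^ (1 / (1 - s))) := by gcongr
      _ ≤ _ := by gcongr; linarith
  have hQ : X ≤ ∫ x, (deriv (deriv u) x ^ 2 + u x ^ 2) := by
    have hv' := (SchwartzMap.derivCLM ℝ ℝ v).integrable_sq_real
    simp only [SchwartzMap.coe_derivCLM_real] at hv'
    rw [hX]
    refine integral_mono hv' ?_ fun x => ?_
    · simpa only [hvu] using hv'.fun_add u.integrable_sq_real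
    · simp only [hvu]
      nlinarith [sq_nonneg (u x)]
  rw [Ifun, ← hvu]
  rw [← hvu] at hQ
  linarith

theorem Continuous.integrable_of_eq_zero_of_lt_abs {f : ℝ → ℝ} (hf : Continuous f) {L : ℝ}
    (h : ∀ x, L < |x| → f x = 0) : Integrable f :=
  hf.integrable_of_hasCompactSupport <|
    HasCompactSupport.intro (isCompact_Icc (a := -L) (b := L)) fun x hx =>
      h x (not_le.1 fun hle => hx (abs_le.1 hle))

theorem integral_le_of_le_of_eq_zero {f : ℝ → ℝ} {C L : ℝ} (hL : 0 ≤ L) (hC : 0 ≤ C)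
    (hle : ∀ x, f x ≤ C) (h : ∀ x, L < |x| → f x = 0) : ∫ x, f x ≤ 2 * L * C := by
  have hsupp : ∀ x, x ∉ Set.Icc (-L) L → f x = 0 := fun x hx =>
    h x (not_le.1 fun hle => hx (abs_le.1 hle))
  by_cases hint : Integrable f
  · rw [← setIntegral_eq_integral_of_forall_compl_eq_zero hsupp]
    calc ∫ x in Set.Icc (-L) L, f x ≤ ∫ _ in Set.Icc (-L) L, C :=
          setIntegral_mono hint.integrableOn (by simp) hle
      _ = 2 * L * C := by
          rw [setIntegral_const, Real.volume_real_Icc_of_le (by linarith), smul_eq_mul]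
          ring
  · rw [integral_undef hint]
    positivity

theorem integral_eq_zero_of_neg_eq_neg {f : ℝ → ℝ} (h : ∀ x, f (-x) = -f x) : ∫ x, f x = 0 := by
  have h1 := integral_neg_eq_self f volume
  simp_rw [h, integral_neg] at h1
  linarith

theorem abs_rpow_sub_two_mul_mul {p : ℝ} (hp : p ≠ 0) (x : ℝ) :
    |x| ^ (p - 2) * x * x = |x| ^ p := by
  rcases eq_or_ne x 0 with rfl | hx
  · simp [Real.zero_rpow hp]
  · rw [mul_assoc, ← abs_mul_abs_self, ← mul_assoc, ← Real.rpow_add_one (abs_ne_zero.2 hx),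
      ← Real.rpow_add_one (abs_ne_zero.2 hx)]
    ring_nf

theorem hasDerivAt_abs_rpow_mul_self {p : ℝ} (hp : 1 < p) (x : ℝ) :
    HasDerivAt (fun y : ℝ => |y| ^ p * y) ((p + 1) * |x| ^ p) x := by
  refine ((hasDerivAt_abs_rpow x hp).fun_mul (hasDerivAt_id' x)).congr_deriv ?_
  rw [← abs_rpow_sub_two_mul_mul (by linarith : p ≠ 0) x]
  ring

theorem abs_rpow_mul_self_add_ge {p : ℝ} (hp : 1 < p) (L : ℝ) : ∃ K : ℝ, 0 ≤ K ∧
    ∀ s t : ℝ, |s| ≤ L → |s + t| ≤ L →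
      |s| ^ p * s + (p + 1) * |s| ^ p * t - K * t ^ 2 ≤ |s + t| ^ p * (s + t) := by
  refine ⟨(p + 1) * (p * |L| ^ (p - 1)), by positivity, fun s t hs hst => ?_⟩
  have hlip : ∀ x y : ℝ, |x| ≤ L → |y| ≤ L →
      |(|y| ^ p - |x| ^ p)| ≤ p * |L| ^ (p - 1) * |y - x| := fun x y hx hy => by
    refine Convex.norm_image_sub_le_of_norm_hasDerivWithin_le (s := Set.Icc (-L) L)
      (fun z _ => (hasDerivAt_abs_rpow z hp).hasDerivWithinAt) (fun z hz => ?_)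
      (convex_Icc _ _) (abs_le.1 hx) (abs_le.1 hy)
    have hzL : |z| ≤ |L| := (abs_le.2 hz).trans (le_abs_self L)
    rw [Real.norm_eq_abs, abs_mul, abs_mul, abs_of_pos (by linarith : 0 < p),
      abs_of_nonneg (Real.rpow_nonneg (abs_nonneg z) _), mul_assoc]
    gcongr
    rcases eq_or_ne z 0 with rfl | hz0
    · simp only [abs_zero, mul_zero]
      positivity
    · rw [← Real.rpow_add_one (abs_ne_zero.2 hz0)]
      calc |z| ^ (p - 2 + 1) = |z| ^ (p - 1) := by ring_nf
        _ ≤ _ := Real.rpow_le_rpow (abs_nonneg z) hzL (by linarith)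
  set K := p * |L| ^ (p - 1)
  have hK : 0 ≤ K := by positivity
  obtain ⟨ξ, hξ1, hξ2, hξ⟩ : ∃ ξ : ℝ, |ξ| ≤ L ∧ |ξ - s| ≤ |t| ∧
      |s + t| ^ p * (s + t) - |s| ^ p * s = (p + 1) * |ξ| ^ p * t := by
    have hd := hasDerivAt_abs_rpow_mul_self hp
    have hc : Continuous fun y : ℝ => |y| ^ p * y :=
      continuous_iff_continuousAt.2 fun x => (hd x).continuousAt
    rw [abs_le] at hs hst
    rcases lt_trichotomy t 0 with ht | rfl | ht
    · obtain ⟨ξ, ⟨h1, h2⟩, h3⟩ := exists_hasDerivAt_eq_slope _ _ (by linarith : s + t < s)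
        hc.continuousOn fun x _ => hd x
      refine ⟨ξ, abs_le.2 ⟨by linarith, by linarith⟩, ?_, ?_⟩
      · rw [abs_of_neg ht, abs_le]; constructor <;> linarith
      · rw [h3, sub_add_cancel_left, div_mul_eq_mul_div, eq_div_iff (by linarith)]
        ring
    · exact ⟨s, abs_le.2 hs, by simp, by simp⟩
    · obtain ⟨ξ, ⟨h1, h2⟩, h3⟩ := exists_hasDerivAt_eq_slope _ _ (by linarith : s < s + t)
        hc.continuousOn fun x _ => hd x
      refine ⟨ξ, abs_le.2 ⟨by linarith, by linarith⟩, ?_, ?_⟩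
      · rw [abs_of_pos ht, abs_le]; constructor <;> linarith
      · rw [h3, add_sub_cancel_left, div_mul_cancel₀ _ ht.ne']
  have h1 : |(|ξ| ^ p - |s| ^ p) * t| ≤ K * t ^ 2 := by
    rw [abs_mul, ← sq_abs t, pow_two, ← mul_assoc]
    gcongr
    exact (hlip s ξ hs hξ1).trans (by gcongr)
  have h2 := neg_le_of_abs_le h1
  nlinarith

/-- A smooth even cutoff, equal to `1` on `[-1, 1]` and vanishing outside `(-2, 2)`. -/
noncomputable def cutoffBump : ContDiffBump (0 : ℝ) := ⟨1, 2, one_pos, one_lt_two⟩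

/-- The cutoff `cutoffBump` as a Schwartz function. -/
noncomputable def cutoff : 𝓢(ℝ, ℝ) :=
  cutoffBump.hasCompactSupport.toSchwartzMap cutoffBump.contDiff

theorem cutoff_neg (y : ℝ) : cutoff (-y) = cutoff y := cutoffBump.neg y

theorem cutoff_nonneg (y : ℝ) : 0 ≤ cutoff y := cutoffBump.nonneg' y

theorem cutoff_le_one (y : ℝ) : cutoff y ≤ 1 := cutoffBump.le_one

theorem cutoff_eq_one {y : ℝ} (hy : |y| ≤ 1) : cutoff y = 1 :=
  cutoffBump.one_of_mem_closedBall (by simpa [cutoffBump] using hy)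

theorem cutoff_eq_zero {y : ℝ} (hy : 2 < |y|) : cutoff y = 0 :=
  cutoffBump.zero_of_le_dist (by simpa [cutoffBump] using hy.le)

theorem deriv_cutoff_eq_zero_of_le {y : ℝ} (hy : |y| ≤ 1) : deriv cutoff y = 0 :=
  IsLocalMax.deriv_eq_zero <| Filter.Eventually.of_forall fun z => by
    rw [cutoff_eq_one hy]
    exact cutoff_le_one z

theorem deriv_cutoff_eq_zero {y : ℝ} (hy : 2 < |y|) : deriv cutoff y = 0 :=
  IsLocalMin.deriv_eq_zero <| Filter.Eventually.of_forall fun z => by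
    rw [cutoff_eq_zero hy]
    exact cutoff_nonneg z

theorem deriv_deriv_cutoff_eq_zero {y : ℝ} (hy : 2 < |y|) : deriv (deriv cutoff) y = 0 := by
  have h : deriv cutoff =ᶠ[nhds y] fun _ => 0 := by
    filter_upwards [(isOpen_lt continuous_const continuous_abs).mem_nhds hy] with z hz
    exact deriv_cutoff_eq_zero hz
  rw [h.deriv_eq, deriv_const]

theorem deriv_cutoff_neg (y : ℝ) : deriv cutoff (-y) = -deriv cutoff y := by
  have h : deriv (fun z => cutoff (-z)) y = deriv cutoff y := by simp_rw [cutoff_neg]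
  rw [deriv_comp_neg] at h
  linarith

theorem exists_cutoff_bound : ∃ M : ℝ, 1 ≤ M ∧ ∀ y, |deriv cutoff y| ≤ M ∧
    |deriv (deriv cutoff) y| ≤ M := by
  set φ₁ := SchwartzMap.derivCLM ℝ ℝ cutoff
  set φ₂ := SchwartzMap.derivCLM ℝ ℝ φ₁
  refine ⟨max 1 (max (SchwartzMap.seminorm ℝ 0 0 φ₁) (SchwartzMap.seminorm ℝ 0 0 φ₂)),
    le_max_left _ _, fun y => ⟨?_, ?_⟩⟩
  · have := SchwartzMap.norm_le_seminorm ℝ φ₁ y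
    rw [SchwartzMap.coe_derivCLM_real] at this
    exact this.trans ((le_max_left _ _).trans (le_max_right _ _))
  · have := SchwartzMap.norm_le_seminorm ℝ φ₂ y
    rw [SchwartzMap.coe_derivCLM_real, SchwartzMap.coe_derivCLM_real] at this
    exact this.trans ((le_max_right _ _).trans (le_max_right _ _))

theorem SchwartzMap.hasDerivAt_comp_div (ψ : 𝓢(ℝ, ℝ)) (c x : ℝ) :
    HasDerivAt (fun y => ψ (y / c)) (deriv ψ (x / c) / c) x := by
  refine ((ψ.hasDerivAt (x / c)).comp x ((hasDerivAt_id' x).div_const c)).congr_deriv ?_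
  ring

theorem integral_abs_sin_rpow_mul_cos_sq_pos {p : ℝ} (hp : 0 < p) :
    0 < ∫ x in (0 : ℝ)..Real.pi, |Real.sin x| ^ p * Real.cos x ^ 2 := by
  have hcont : Continuous fun x => |Real.sin x| ^ p * Real.cos x ^ 2 :=
    (Real.continuous_sin.abs.rpow_const fun _ => Or.inr hp.le).mul (Real.continuous_cos.pow 2)
  refine intervalIntegral.integral_pos Real.pi_pos hcont.continuousOn
    (fun x _ => by positivity)
    ⟨Real.pi / 4, ⟨by positivity, by linarith [Real.pi_pos]⟩, ?_⟩
  rw [Real.sin_pi_div_four, Real.cos_pi_div_four]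
  positivity

theorem integral_abs_sin_rpow_mul_cos_sq_nat_mul {p : ℝ} (hp : 0 < p) (n : ℕ) :
    ∫ x in (0 : ℝ)..(n * Real.pi), |Real.sin x| ^ p * Real.cos x ^ 2
      = n * ∫ x in (0 : ℝ)..Real.pi, |Real.sin x| ^ p * Real.cos x ^ 2 := by
  have hcont : Continuous fun x => |Real.sin x| ^ p * Real.cos x ^ 2 :=
    (Real.continuous_sin.abs.rpow_const fun _ => Or.inr hp.le).mul (Real.continuous_cos.pow 2)
  have hper : Function.Periodic (fun x => |Real.sin x| ^ p * Real.cos x ^ 2) Real.pi := fun x => by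
    simp
  simpa using hper.intervalIntegral_add_zsmul_eq n 0 fun _ _ => hcont.intervalIntegrable _ _

/-- The derivative of the carrier wave `φ(x / 2R) cos x`. -/
noncomputable def carrierDeriv (R x : ℝ) : ℝ :=
  deriv cutoff (x / (2 * R)) / (2 * R) * Real.cos x - cutoff (x / (2 * R)) * Real.sin x

/-- The derivative of the second harmonic `-φ(x / R) sin x cos x`. -/
noncomputable def harmonicDeriv (R x : ℝ) : ℝ :=
  -(deriv cutoff (x / R) / R * (Real.sin x * Real.cos x)
    + cutoff (x / R) * (Real.cos x ^ 2 - Real.sin x ^ 2))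

theorem hasDerivAt_carrier (R x : ℝ) :
    HasDerivAt (fun y => cutoff (y / (2 * R)) * Real.cos y) (carrierDeriv R x) x := by
  refine ((cutoff.hasDerivAt_comp_div (2 * R) x).fun_mul (Real.hasDerivAt_cos x)).congr_deriv ?_
  rw [carrierDeriv]
  ring

theorem hasDerivAt_harmonic (R x : ℝ) :
    HasDerivAt (fun y => -(cutoff (y / R) * (Real.sin y * Real.cos y))) (harmonicDeriv R x) x := by
  refine ((cutoff.hasDerivAt_comp_div R x).fun_mul
    ((Real.hasDerivAt_sin x).fun_mul (Real.hasDerivAt_cos x))).fun_neg.congr_deriv ?_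
  rw [harmonicDeriv]
  ring

theorem hasDerivAt_deriv_cutoff_comp_div (c x : ℝ) :
    HasDerivAt (fun y => deriv cutoff (y / c)) (deriv (deriv cutoff) (x / c) / c) x := by
  simpa only [SchwartzMap.coe_derivCLM_real] using
    (SchwartzMap.derivCLM ℝ ℝ cutoff).hasDerivAt_comp_div c x

theorem hasDerivAt_carrierDeriv (R x : ℝ) :
    HasDerivAt (carrierDeriv R)
      (deriv (deriv cutoff) (x / (2 * R)) / (2 * R) / (2 * R) * Real.cos x
        - 2 * (deriv cutoff (x / (2 * R)) / (2 * R)) * Real.sin x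
        - cutoff (x / (2 * R)) * Real.cos x) x := by
  refine ((((hasDerivAt_deriv_cutoff_comp_div (2 * R) x).div_const (2 * R)).fun_mul
    (Real.hasDerivAt_cos x)).fun_sub
    ((cutoff.hasDerivAt_comp_div (2 * R) x).fun_mul (Real.hasDerivAt_sin x))).congr_deriv ?_
  ring

theorem hasDerivAt_harmonicDeriv (R x : ℝ) :
    HasDerivAt (harmonicDeriv R)
      (-(deriv (deriv cutoff) (x / R) / R / R * (Real.sin x * Real.cos x)
        + 2 * (deriv cutoff (x / R) / R) * (Real.cos x ^ 2 - Real.sin x ^ 2)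
        - 4 * cutoff (x / R) * (Real.sin x * Real.cos x))) x := by
  refine (((((hasDerivAt_deriv_cutoff_comp_div R x).div_const R).fun_mul
    ((Real.hasDerivAt_sin x).fun_mul (Real.hasDerivAt_cos x))).fun_add
    ((cutoff.hasDerivAt_comp_div R x).fun_mul
      (((Real.hasDerivAt_cos x).fun_pow 2).fun_sub
        ((Real.hasDerivAt_sin x).fun_pow 2)))).fun_neg).congr_deriv ?_
  push_cast
  ring

theorem continuous_carrierDeriv (R : ℝ) : Continuous (carrierDeriv R) :=
  continuous_iff_continuousAt.2 fun x => (hasDerivAt_carrierDeriv R x).continuousAt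

theorem continuous_harmonicDeriv (R : ℝ) : Continuous (harmonicDeriv R) :=
  continuous_iff_continuousAt.2 fun x => (hasDerivAt_harmonicDeriv R x).continuousAt

theorem carrierDeriv_neg (R x : ℝ) : carrierDeriv R (-x) = -carrierDeriv R x := by
  simp only [carrierDeriv, neg_div, deriv_cutoff_neg, cutoff_neg, Real.cos_neg, Real.sin_neg]
  ring

theorem two_lt_abs_div {c x : ℝ} (hc : 0 < c) (hx : 2 * c < |x|) : 2 < |x / c| := by
  rwa [abs_div, abs_of_pos hc, lt_div_iff₀ hc]

theorem carrierDeriv_eq_zero {R x : ℝ} (hR : 0 < R) (hx : 4 * R < |x|) :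
    carrierDeriv R x = 0 := by
  have h := two_lt_abs_div (c := 2 * R) (by positivity) (by linarith : 2 * (2 * R) < |x|)
  simp [carrierDeriv, deriv_cutoff_eq_zero h, cutoff_eq_zero h]

theorem harmonicDeriv_eq_zero {R x : ℝ} (hR : 0 < R) (hx : 2 * R < |x|) :
    harmonicDeriv R x = 0 := by
  have h := two_lt_abs_div hR hx
  simp [harmonicDeriv, deriv_cutoff_eq_zero h, cutoff_eq_zero h]

theorem carrierDeriv_eq_neg_sin {R x : ℝ} (hR : 0 < R) (hx : |x| ≤ 2 * R) :
    carrierDeriv R x = -Real.sin x := by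
  have h : |x / (2 * R)| ≤ 1 := by
    rwa [abs_div, abs_of_pos (by positivity : 0 < 2 * R), div_le_one (by positivity)]
  simp [carrierDeriv, deriv_cutoff_eq_zero_of_le h, cutoff_eq_one h]

/-- The carrier and the second harmonic interact with the right sign. -/
theorem integral_abs_sin_rpow_mul_harmonicDeriv_ge {p : ℝ} (hp : 1 < p) {n : ℕ} (hn : 0 < n) :
    n * (p * ∫ x in (0 : ℝ)..Real.pi, |Real.sin x| ^ p * Real.cos x ^ 2)
      ≤ ∫ x, |Real.sin x| ^ p * harmonicDeriv (n * Real.pi) x := by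
  set R := n * Real.pi with hRdef
  have hR : 0 < R := by positivity
  have hsin : Continuous fun x => |Real.sin x| ^ p :=
    Real.continuous_sin.abs.rpow_const fun _ => Or.inr (by linarith)
  have hcut : Continuous fun x => cutoff (x / R) :=
    cutoff.continuous.comp (continuous_id.div_const R)
  have hcut0 : ∀ x, 2 * R < |x| → cutoff (x / R) = 0 := fun x hx =>
    cutoff_eq_zero (two_lt_abs_div hR hx)
  have hiG : Integrable fun x => |Real.sin x| ^ p * Real.cos x ^ 2 * cutoff (x / R) :=
    ((hsin.mul (Real.continuous_cos.pow 2)).mul hcut).integrable_of_eq_zero_of_lt_abs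
      (L := 2 * R) fun x hx => by simp [hcut0 x hx]
  have hiH : Integrable fun x => |Real.sin x| ^ p * harmonicDeriv R x :=
    (hsin.mul (continuous_harmonicDeriv R)).integrable_of_eq_zero_of_lt_abs
      (L := 2 * R) fun x hx => by simp [harmonicDeriv_eq_zero hR hx]
  have hiF : Integrable fun x =>
      |Real.sin x| ^ p * -(cutoff (x / R) * (Real.sin x * Real.cos x)) :=
    (hsin.mul (hcut.mul
      (Real.continuous_sin.mul Real.continuous_cos)).neg).integrable_of_eq_zero_of_lt_abs
      (L := 2 * R) fun x hx => by simp [hcut0 x hx]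
  have hderiv : ∀ x, HasDerivAt
      (fun x => |Real.sin x| ^ p * -(cutoff (x / R) * (Real.sin x * Real.cos x)))
      (|Real.sin x| ^ p * harmonicDeriv R x
        - p * (|Real.sin x| ^ p * Real.cos x ^ 2 * cutoff (x / R))) x := fun x => by
    refine (((hasDerivAt_abs_rpow (Real.sin x) hp).comp x (Real.hasDerivAt_sin x)).fun_mul
      (hasDerivAt_harmonic R x)).congr_deriv ?_
    simp only [Function.comp_apply]
    rw [← abs_rpow_sub_two_mul_mul (by linarith : p ≠ 0) (Real.sin x)]
    ring
  have hzero := integral_eq_zero_of_hasDerivAt_of_integrable hderiv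
    (hiH.sub (hiG.const_mul p)) hiF
  rw [integral_sub hiH (hiG.const_mul p), integral_const_mul, sub_eq_zero] at hzero
  rw [hzero, mul_left_comm, ← integral_abs_sin_rpow_mul_cos_sq_nat_mul (by linarith),
    intervalIntegral.integral_of_le hR.le]
  gcongr
  calc _ = ∫ x in Set.Ioc 0 R, |Real.sin x| ^ p * Real.cos x ^ 2 * cutoff (x / R) := by
        refine setIntegral_congr_fun measurableSet_Ioc fun x hx => ?_
        have : |x / R| ≤ 1 := by
          rw [abs_of_nonneg (div_nonneg hx.1.le hR.le), div_le_one hR]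
          exact hx.2
        simp only [cutoff_eq_one this, mul_one]
    _ ≤ _ := setIntegral_le_integral hiG <| Filter.Eventually.of_forall fun x => by
        have := cutoff_nonneg (x / R)
        positivity

/-- The trial profile: a slowly modulated carrier wave plus `b` times its second harmonic. -/
theorem exists_schwartz_carrier_add_harmonic {R : ℝ} (hR : 0 < R) (b : ℝ) :
    ∃ w : 𝓢(ℝ, ℝ), ∀ x, w x = cutoff (x / (2 * R)) * Real.cos x
      + b * -(cutoff (x / R) * (Real.sin x * Real.cos x)) := by
  have hsupp : HasCompactSupport fun x => cutoff (x / (2 * R)) * Real.cos x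
      + b * -(cutoff (x / R) * (Real.sin x * Real.cos x)) :=
    HasCompactSupport.intro (isCompact_Icc (a := -(4 * R)) (b := 4 * R)) fun x hx => by
      have hx' : 4 * R < |x| := not_le.1 fun hle => hx (abs_le.1 hle)
      rw [cutoff_eq_zero (two_lt_abs_div (by positivity) (by linarith)),
        cutoff_eq_zero (two_lt_abs_div hR (by linarith))]
      ring
  have hφ : ContDiff ℝ (⊤ : ℕ∞) cutoff := cutoff.smooth ⊤
  exact ⟨hsupp.toSchwartzMap (by fun_prop), fun x => rfl⟩

theorem abs_carrierDeriv_le {M R : ℝ} (hM : ∀ y, |deriv cutoff y| ≤ M) (hR : 1 ≤ R) (x : ℝ) :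
    |carrierDeriv R x| ≤ M + 1 := by
  have h1 : |deriv cutoff (x / (2 * R)) / (2 * R)| ≤ M := by
    rw [abs_div, abs_of_pos (by linarith : 0 < 2 * R)]
    exact (div_le_self (abs_nonneg _) (by linarith)).trans (hM _)
  calc |carrierDeriv R x|
      ≤ |deriv cutoff (x / (2 * R)) / (2 * R)| * |Real.cos x|
        + |cutoff (x / (2 * R))| * |Real.sin x| := by
        rw [← abs_mul, ← abs_mul]
        exact abs_sub _ _
    _ ≤ M * 1 + 1 * 1 := by
        have := (abs_nonneg _).trans h1
        rw [abs_of_nonneg (cutoff_nonneg _)]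
        gcongr
        exacts [Real.abs_cos_le_one x, cutoff_le_one _, Real.abs_sin_le_one x]
    _ = M + 1 := by ring

theorem abs_sin_mul_cos_le_one (x : ℝ) : |Real.sin x * Real.cos x| ≤ 1 := by
  rw [abs_mul]
  exact mul_le_one₀ (Real.abs_sin_le_one x) (abs_nonneg _) (Real.abs_cos_le_one x)

theorem abs_cos_sq_sub_sin_sq_le_one (x : ℝ) : |Real.cos x ^ 2 - Real.sin x ^ 2| ≤ 1 := by
  rw [← Real.cos_two_mul']
  exact Real.abs_cos_le_one _

theorem abs_harmonicDeriv_le {M R : ℝ} (hM : ∀ y, |deriv cutoff y| ≤ M) (hR : 1 ≤ R) (x : ℝ) :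
    |harmonicDeriv R x| ≤ M + 1 := by
  have h1 : |deriv cutoff (x / R) / R| ≤ M := by
    rw [abs_div, abs_of_pos (by linarith : 0 < R)]
    exact (div_le_self (abs_nonneg _) hR).trans (hM _)
  calc |harmonicDeriv R x|
      ≤ |deriv cutoff (x / R) / R| * |Real.sin x * Real.cos x|
        + |cutoff (x / R)| * |Real.cos x ^ 2 - Real.sin x ^ 2| := by
        rw [← abs_mul, ← abs_mul, harmonicDeriv, abs_neg]
        exact abs_add_le _ _
    _ ≤ M * 1 + 1 * 1 := by
        have := (abs_nonneg _).trans h1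
        rw [abs_of_nonneg (cutoff_nonneg _)]
        gcongr
        exacts [abs_sin_mul_cos_le_one x, cutoff_le_one _, abs_cos_sq_sub_sin_sq_le_one x]
    _ = M + 1 := by ring

theorem abs_carrier_defect_le {M R : ℝ} (hM1 : ∀ y, |deriv cutoff y| ≤ M)
    (hM2 : ∀ y, |deriv (deriv cutoff) y| ≤ M) (hR : 1 ≤ R) (x : ℝ) :
    |deriv (deriv cutoff) (x / (2 * R)) / (2 * R) / (2 * R) * Real.cos x
      - 2 * (deriv cutoff (x / (2 * R)) / (2 * R)) * Real.sin x| ≤ 3 * M / R := by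
  have hM0 : 0 ≤ M := (abs_nonneg _).trans (hM1 0)
  have hR0 : 0 < R := by linarith
  have h1 : |deriv cutoff (x / (2 * R)) / (2 * R)| ≤ M / R := by
    rw [abs_div, abs_of_pos (by linarith : 0 < 2 * R)]
    gcongr
    exacts [hM1 _, by linarith]
  have h2 : |deriv (deriv cutoff) (x / (2 * R)) / (2 * R) / (2 * R)| ≤ M / R := by
    rw [abs_div, abs_div, abs_of_pos (by linarith : 0 < 2 * R)]
    gcongr
    · exact (div_le_self (abs_nonneg _) (by linarith)).trans (hM2 _)
    · linarith
  calc _ ≤ |deriv (deriv cutoff) (x / (2 * R)) / (2 * R) / (2 * R)| * |Real.cos x|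
        + 2 * |deriv cutoff (x / (2 * R)) / (2 * R)| * |Real.sin x| := by
        rw [← abs_mul, ← abs_two (α := ℝ), ← abs_mul, ← abs_mul, abs_two]
        exact abs_sub _ _
    _ ≤ M / R * 1 + 2 * (M / R) * 1 := by
        gcongr
        exacts [Real.abs_cos_le_one x, Real.abs_sin_le_one x]
    _ = 3 * M / R := by ring

theorem abs_harmonic_defect_le {M R : ℝ} (hM1 : ∀ y, |deriv cutoff y| ≤ M)
    (hM2 : ∀ y, |deriv (deriv cutoff) y| ≤ M) (hR : 1 ≤ R) (x : ℝ) :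
    |deriv (deriv cutoff) (x / R) / R / R * (Real.sin x * Real.cos x)
        + 2 * (deriv cutoff (x / R) / R) * (Real.cos x ^ 2 - Real.sin x ^ 2)
        - 3 * cutoff (x / R) * (Real.sin x * Real.cos x)| ≤ 3 * M + 3 := by
  have hM0 : 0 ≤ M := (abs_nonneg _).trans (hM1 0)
  have hR0 : 0 < R := by linarith
  have h1 : |deriv cutoff (x / R) / R| ≤ M := by
    rw [abs_div, abs_of_pos hR0]
    exact (div_le_self (abs_nonneg _) hR).trans (hM1 _)
  have h2 : |deriv (deriv cutoff) (x / R) / R / R| ≤ M := by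
    rw [abs_div, abs_div, abs_of_pos hR0]
    exact (div_le_self (by positivity) hR).trans ((div_le_self (abs_nonneg _) hR).trans (hM2 _))
  have h3 : |cutoff (x / R)| ≤ 1 := by
    rw [abs_of_nonneg (cutoff_nonneg _)]
    exact cutoff_le_one _
  calc _ ≤ |deriv (deriv cutoff) (x / R) / R / R| * |Real.sin x * Real.cos x|
        + 2 * |deriv cutoff (x / R) / R| * |Real.cos x ^ 2 - Real.sin x ^ 2|
        + 3 * |cutoff (x / R)| * |Real.sin x * Real.cos x| := by
        refine (abs_sub _ _).trans (add_le_add ((abs_add_le _ _).trans (le_of_eq ?_)) (le_of_eq ?_))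
        · simp only [abs_mul, abs_two]
        · simp only [abs_mul, Nat.abs_ofNat]
    _ ≤ M * 1 + 2 * M * 1 + 3 * 1 * 1 := by
        gcongr
        exacts [abs_sin_mul_cos_le_one x, abs_cos_sq_sub_sin_sq_le_one x, abs_sin_mul_cos_le_one x]
    _ = 3 * M + 3 := by ring

theorem exists_trial_function {p : ℝ} (hp : 1 < p) :
    ∃ c C κ : ℝ, 0 < c ∧ 0 < C ∧ 0 < κ ∧ ∀ n : ℕ, 0 < n → ∀ b : ℝ, 0 ≤ b → b ≤ κ →
      ∃ w : 𝓢(ℝ, ℝ), ∫ x, deriv w x ^ 2 ≤ C * (n * Real.pi) ∧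
        ∫ x, (deriv (deriv w) x + w x) ^ 2
          ≤ C * (n * Real.pi) * (1 / (n * Real.pi) ^ 2 + b ^ 2) ∧
        n * Real.pi * (c * b - C * b ^ 2)
          ≤ 1 / (p + 1) * ∫ x, |deriv w x| ^ p * deriv w x := by
  obtain ⟨M, hM, hbound⟩ := exists_cutoff_bound
  have hM1 := fun y => (hbound y).1
  have hM2 := fun y => (hbound y).2
  obtain ⟨K, hK, hpow⟩ := abs_rpow_mul_self_add_ge hp (M + 2)
  set c₀ := ∫ x in (0 : ℝ)..Real.pi, |Real.sin x| ^ p * Real.cos x ^ 2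
  have hc₀ : 0 < c₀ := integral_abs_sin_rpow_mul_cos_sq_pos (by linarith)
  set C := 144 * (M + 2) ^ 2 + 4 * K * (M + 1) ^ 2 / (p + 1) with hC
  have hC1 : 144 * (M + 2) ^ 2 ≤ C := le_add_of_nonneg_right (by positivity)
  have hC2 : 4 * K * (M + 1) ^ 2 / (p + 1) ≤ C := le_add_of_nonneg_left (by positivity)
  refine ⟨p * c₀ / Real.pi, C, 1 / (M + 1), by positivity, by positivity, by positivity,
    fun n hn b hb0 hb => ?_⟩
  set R := n * Real.pi with hRdef
  have hR1 : 1 ≤ R := by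
    have : (1 : ℝ) ≤ n := by exact_mod_cast hn
    nlinarith [Real.pi_gt_three]
  have hR : 0 < R := by linarith
  have hbM : b * (M + 1) ≤ 1 := by rwa [le_div_iff₀ (by linarith)] at hb
  obtain ⟨w, hw⟩ := exists_schwartz_carrier_add_harmonic hR b
  have hw1 : deriv w = fun x => carrierDeriv R x + b * harmonicDeriv R x := funext fun x => by
    rw [funext hw]
    exact ((hasDerivAt_carrier R x).fun_add ((hasDerivAt_harmonic R x).const_mul b)).deriv
  have hw2 : ∀ x, deriv (deriv w) x + w x =
      (deriv (deriv cutoff) (x / (2 * R)) / (2 * R) / (2 * R) * Real.cos x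
        - 2 * (deriv cutoff (x / (2 * R)) / (2 * R)) * Real.sin x)
      - b * (deriv (deriv cutoff) (x / R) / R / R * (Real.sin x * Real.cos x)
        + 2 * (deriv cutoff (x / R) / R) * (Real.cos x ^ 2 - Real.sin x ^ 2)
        - 3 * cutoff (x / R) * (Real.sin x * Real.cos x)) := fun x => by
    rw [hw1, hw, ((hasDerivAt_carrierDeriv R x).fun_add
      ((hasDerivAt_harmonicDeriv R x).const_mul b)).deriv]
    ring
  have hg := abs_carrierDeriv_le hM1 hR1
  have hh := abs_harmonicDeriv_le hM1 hR1
  have hsum : ∀ x, |carrierDeriv R x + b * harmonicDeriv R x| ≤ M + 2 := fun x =>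
    calc |carrierDeriv R x + b * harmonicDeriv R x|
        ≤ |carrierDeriv R x| + b * |harmonicDeriv R x| := by
          rw [← abs_of_nonneg hb0, ← abs_mul, abs_of_nonneg hb0]
          exact abs_add_le _ _
      _ ≤ (M + 1) + b * (M + 1) := by gcongr; exacts [hg x, hh x]
      _ ≤ M + 2 := by linarith
  refine ⟨w, ?_, ?_, ?_⟩
  · calc ∫ x, deriv w x ^ 2 ≤ 2 * (4 * R) * (M + 2) ^ 2 := by
          refine integral_le_of_le_of_eq_zero (by positivity) (by positivity) (fun x => ?_)
            fun x hx => ?_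
          · rw [hw1]
            exact sq_le_sq' (neg_le_of_abs_le (hsum x)) (le_of_abs_le (hsum x))
          · rw [hw1]
            simp [carrierDeriv_eq_zero hR hx, harmonicDeriv_eq_zero hR (by linarith : 2 * R < |x|)]
      _ = 8 * (M + 2) ^ 2 * R := by ring
      _ ≤ C * R := by gcongr; nlinarith [sq_nonneg (M + 2)]
  · calc ∫ x, (deriv (deriv w) x + w x) ^ 2
        ≤ 2 * (4 * R) * (18 * (M + 2) ^ 2 * (1 / R ^ 2 + b ^ 2)) := by
          refine integral_le_of_le_of_eq_zero (by positivity) (by positivity) (fun x => ?_)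
            fun x hx => ?_
          · rw [hw2]
            have h1 := sq_le_sq' (neg_le_of_abs_le (abs_carrier_defect_le hM1 hM2 hR1 x))
              (le_of_abs_le (abs_carrier_defect_le hM1 hM2 hR1 x))
            have h2 := sq_le_sq' (neg_le_of_abs_le (abs_harmonic_defect_le hM1 hM2 hR1 x))
              (le_of_abs_le (abs_harmonic_defect_le hM1 hM2 hR1 x))
            set X := deriv (deriv cutoff) (x / (2 * R)) / (2 * R) / (2 * R) * Real.cos x
              - 2 * (deriv cutoff (x / (2 * R)) / (2 * R)) * Real.sin x
            set Y := deriv (deriv cutoff) (x / R) / R / R * (Real.sin x * Real.cos x)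
              + 2 * (deriv cutoff (x / R) / R) * (Real.cos x ^ 2 - Real.sin x ^ 2)
              - 3 * cutoff (x / R) * (Real.sin x * Real.cos x)
            calc (X - b * Y) ^ 2 ≤ 2 * X ^ 2 + 2 * b ^ 2 * Y ^ 2 := by
                  nlinarith [sq_nonneg (X + b * Y)]
              _ ≤ 2 * (3 * M / R) ^ 2 + 2 * b ^ 2 * (3 * M + 3) ^ 2 := by gcongr
              _ = 18 * M ^ 2 * (1 / R ^ 2) + 18 * (M + 1) ^ 2 * b ^ 2 := by ring
              _ ≤ 18 * (M + 2) ^ 2 * (1 / R ^ 2) + 18 * (M + 2) ^ 2 * b ^ 2 := by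
                  gcongr <;> linarith
              _ = _ := by ring
          · have h1 := two_lt_abs_div (c := 2 * R) (by positivity) (by linarith : 2 * (2 * R) < |x|)
            have h2 := two_lt_abs_div hR (by linarith : 2 * R < |x|)
            simp [hw2, deriv_deriv_cutoff_eq_zero h1, deriv_deriv_cutoff_eq_zero h2,
              deriv_cutoff_eq_zero h1, deriv_cutoff_eq_zero h2, cutoff_eq_zero h2]
      _ = 144 * (M + 2) ^ 2 * R * (1 / R ^ 2 + b ^ 2) := by ring
      _ ≤ C * R * (1 / R ^ 2 + b ^ 2) := by gcongr
  · have hgc := continuous_carrierDeriv R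
    have hhc := continuous_harmonicDeriv R
    have hp0 : 0 ≤ p := by linarith
    have hi1 : Integrable fun x => |carrierDeriv R x| ^ p * carrierDeriv R x :=
      ((hgc.abs.rpow_const fun _ => Or.inr hp0).mul hgc).integrable_of_eq_zero_of_lt_abs
        (L := 4 * R) fun x hx => by simp [carrierDeriv_eq_zero hR hx]
    have hi2 : Integrable fun x => |Real.sin x| ^ p * harmonicDeriv R x :=
      ((Real.continuous_sin.abs.rpow_const fun _ => Or.inr hp0).mul
        hhc).integrable_of_eq_zero_of_lt_abs
        (L := 2 * R) fun x hx => by simp [harmonicDeriv_eq_zero hR hx]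
    have hi3 : Integrable fun x => harmonicDeriv R x ^ 2 :=
      (hhc.pow 2).integrable_of_eq_zero_of_lt_abs
        (L := 2 * R) fun x hx => by simp [harmonicDeriv_eq_zero hR hx]
    have hi4 : Integrable fun x => |deriv w x| ^ p * deriv w x := by
      simpa only [SchwartzMap.coe_derivCLM_real] using
        (SchwartzMap.derivCLM ℝ ℝ w).integrable_abs_rpow_mul hp0
    have hpt : ∀ x, |carrierDeriv R x| ^ p * carrierDeriv R x
        + (p + 1) * b * (|Real.sin x| ^ p * harmonicDeriv R x) - K * b ^ 2 * harmonicDeriv R x ^ 2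
        ≤ |deriv w x| ^ p * deriv w x := fun x => by
      rw [hw1]
      have h := hpow (carrierDeriv R x) (b * harmonicDeriv R x)
        ((hg x).trans (by linarith)) (hsum x)
      rcases le_or_gt |x| (2 * R) with hx | hx
      · have hs : |carrierDeriv R x| = |Real.sin x| := by
          rw [carrierDeriv_eq_neg_sin hR hx, abs_neg]
        refine le_trans (le_of_eq ?_) h
        rw [hs]
        ring
      · simp [harmonicDeriv_eq_zero hR hx]
    have hint := integral_mono ((hi1.fun_add (hi2.const_mul ((p + 1) * b))).sub
      (hi3.const_mul (K * b ^ 2))) hi4 hpt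
    have hodd : ∫ x, |carrierDeriv R x| ^ p * carrierDeriv R x = 0 :=
      integral_eq_zero_of_neg_eq_neg fun x => by rw [carrierDeriv_neg, abs_neg, mul_neg]
    rw [integral_sub' (hi1.fun_add (hi2.const_mul _)) (hi3.const_mul _),
      integral_add hi1 (hi2.const_mul _), integral_const_mul, integral_const_mul, hodd,
      zero_add] at hint
    have hpair := integral_abs_sin_rpow_mul_harmonicDeriv_ge hp hn
    have hsq : ∫ x, harmonicDeriv R x ^ 2 ≤ 2 * (2 * R) * (M + 1) ^ 2 :=
      integral_le_of_le_of_eq_zero (by positivity) (by positivity)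
        (fun x => sq_le_sq' (neg_le_of_abs_le (hh x)) (le_of_abs_le (hh x)))
        fun x hx => by simp [harmonicDeriv_eq_zero hR hx]
    calc R * (p * c₀ / Real.pi * b - C * b ^ 2)
        ≤ R * (p * c₀ / Real.pi * b - 4 * K * (M + 1) ^ 2 / (p + 1) * b ^ 2) := by gcongr
      _ = 1 / (p + 1) * ((p + 1) * b * (n * (p * c₀))
            - K * b ^ 2 * (2 * (2 * R) * (M + 1) ^ 2)) := by
          rw [hRdef]
          field_simp
          ring
      _ ≤ 1 / (p + 1) * _ := by
          gcongr
          refine le_trans ?_ hint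
          gcongr

theorem exists_small_Ifun_lt {p : ℝ} (hp1 : 1 < p) (hp3 : p < 3) {μ : ℝ} (hμ : 0 < μ) :
    ∃ u : 𝓢(ℝ, ℝ), ∫ x, deriv u x ^ 2 ≤ μ ∧ Ifun p u < ∫ x, deriv u x ^ 2 := by
  obtain ⟨c, C, κ₀, hc, hC, hκ₀, htrial⟩ := exists_trial_function hp1
  obtain ⟨κ, hκ, hκκ₀, hκc⟩ : ∃ κ : ℝ, 0 < κ ∧ κ ≤ κ₀ ∧ 4 * C * κ ≤ c := by
    refine ⟨min κ₀ (c / (4 * C)), by positivity, min_le_left _ _, ?_⟩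
    calc 4 * C * min κ₀ (c / (4 * C)) ≤ 4 * C * (c / (4 * C)) := by
          gcongr
          exact min_le_right _ _
      _ = c := by field_simp
  set A := Real.sqrt (4 * C / (κ * c)) with hA
  have hA0 : 0 < A := Real.sqrt_pos.2 (by positivity)
  have hA2 : A ^ 2 * (κ * c) = 4 * C := by
    rw [hA, Real.sq_sqrt (by positivity)]
    field_simp
  set e := 2 / (p - 1) - 1 with he
  have he0 : 0 < e := by
    rw [he, sub_pos, lt_div_iff₀ (by linarith)]
    linarith
  have hlim : Filter.Tendsto (fun n : ℕ => A / (n * Real.pi)) Filter.atTop (nhds 0) :=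
    (tendsto_natCast_atTop_atTop.atTop_mul_const Real.pi_pos).const_div_atTop A
  have hlim2 : Filter.Tendsto (fun n : ℕ => C * A * (A / (n * Real.pi)) ^ e)
      Filter.atTop (nhds 0) := by
    have := (hlim.rpow_const (Or.inr he0.le)).const_mul (C * A)
    rwa [Real.zero_rpow he0.ne', mul_zero] at this
  obtain ⟨n, hn, ht1, hn2⟩ := ((Filter.eventually_gt_atTop 0).and
    ((hlim.eventually_le_const one_pos).and (hlim2.eventually_le_const hμ))).exists
  set R := n * Real.pi with hR
  have hR0 : 0 < R := by positivity
  set t := A / R with ht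
  have ht0 : 0 < t := by positivity
  obtain ⟨w, hw1, hw2, hw3⟩ := htrial n hn (κ * t) (by positivity)
    ((mul_le_of_le_one_right hκ.le ht1).trans hκκ₀)
  rw [← hR] at hw1 hw2 hw3
  set a := t ^ (1 / (p - 1)) with ha
  have ha0 : 0 < a := by positivity
  have hap : a ^ (p - 1) = t := by
    rw [ha, ← Real.rpow_mul ht0.le, one_div_mul_cancel (by linarith), Real.rpow_one]
  have ha2 : a ^ 2 = t * t ^ e := by
    rw [ha, ← Real.rpow_natCast, ← Real.rpow_mul ht0.le, mul_comm t, ← Real.rpow_add_one ht0.ne']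
    congr 1
    rw [he]
    push_cast
    ring
  have hap1 : a ^ (p + 1) = a ^ 2 * t := by
    rw [← hap, ← Real.rpow_natCast, ← Real.rpow_add ha0]
    congr 1
    push_cast
    ring
  refine ⟨a • w, ?_, ?_⟩
  · rw [integral_deriv_smul_sq]
    calc a ^ 2 * ∫ x, deriv w x ^ 2 ≤ t * t ^ e * (C * R) := by rw [ha2]; gcongr
      _ = C * A * t ^ e := by
          have : t * R = A := by rw [ht]; field_simp
          linear_combination C * t ^ e * this
      _ ≤ μ := hn2
  · rw [Ifun_smul ha0, integral_deriv_smul_sq, hap1]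
    set D := ∫ x, (deriv (deriv w) x + w x) ^ 2
    set N := 1 / (p + 1) * ∫ x, |deriv w x| ^ p * deriv w x
    suffices h : 1 / 2 * D < t * N by nlinarith [pow_pos ha0 2]
    have hR2 : 4 * C * (1 / R ^ 2) = t ^ 2 * (κ * c) := by
      rw [← hA2, ht]
      field_simp
    have hmain : C * (1 / R ^ 2 + (κ * t) ^ 2) < 2 * (t * (c * (κ * t) - C * (κ * t) ^ 2)) := by
      have h1 : C * (κ ^ 2 * t ^ 3) ≤ C * (κ ^ 2 * t ^ 2) := by
        have := pow_le_pow_of_le_one ht0.le ht1 (by norm_num : 2 ≤ 3)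
        gcongr
      have h2 : 4 * C * κ * (κ * t ^ 2) ≤ c * (κ * t ^ 2) := by gcongr
      have h3 : 0 < c * (κ * t ^ 2) := by positivity
      nlinarith
    calc 1 / 2 * D ≤ 1 / 2 * (C * R * (1 / R ^ 2 + (κ * t) ^ 2)) := by gcongr
      _ = R * (C * (1 / R ^ 2 + (κ * t) ^ 2)) / 2 := by ring
      _ < R * (2 * (t * (c * (κ * t) - C * (κ * t) ^ 2))) / 2 := by gcongr
      _ = t * (R * (c * (κ * t) - C * (κ * t) ^ 2)) := by ring
      _ ≤ t * N := by gcongr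

theorem exists_Ifun_lt {p : ℝ} (hp1 : 1 < p) (hp3 : p < 3) {α : ℝ} (hα : 0 < α) :
    ∃ u : 𝓢(ℝ, ℝ), ∫ x, deriv u x ^ 2 = α ∧ Ifun p u < α := by
  obtain ⟨u, hu, hI⟩ := exists_small_Ifun_lt hp1 hp3 hα
  have hD : 0 ≤ ∫ x, (deriv (deriv u) x + u x) ^ 2 := integral_nonneg fun x => sq_nonneg _
  have hN : 0 < 1 / (p + 1) * ∫ x, |deriv u x| ^ p * deriv u x := by
    rw [Ifun_eq] at hI
    linarith
  have hpos : 0 < ∫ x, deriv u x ^ 2 := by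
    refine (integral_nonneg fun x => sq_nonneg _).lt_of_ne' fun h0 => hN.ne' ?_
    have hint : Integrable fun x => deriv u x ^ 2 := by
      simpa only [SchwartzMap.coe_derivCLM_real] using
        (SchwartzMap.derivCLM ℝ ℝ u).integrable_sq_real
    have hae := (integral_eq_zero_iff_of_nonneg (fun x => sq_nonneg _) hint).1 h0
    rw [integral_eq_zero_of_ae, mul_zero]
    filter_upwards [hae] with x hx
    have : deriv u x = 0 := by simpa using hx
    simp [this]
  set m := ∫ x, deriv u x ^ 2
  set θ := Real.sqrt (α / m)
  have hθ : 1 ≤ θ := Real.one_le_sqrt.2 ((one_le_div hpos).2 hu)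
  have hθm : θ ^ 2 * m = α := by
    rw [Real.sq_sqrt (by positivity)]
    field_simp
  refine ⟨θ • u, by rw [integral_deriv_smul_sq, hθm], ?_⟩
  rw [Ifun_smul (by linarith)]
  rw [Ifun_eq] at hI
  have hpow : θ ^ 2 ≤ θ ^ (p + 1) := by
    rw [← Real.rpow_natCast]
    exact Real.rpow_le_rpow_of_exponent_le hθ (by push_cast; linarith)
  nlinarith [mul_le_mul_of_nonneg_right hpow hN.le, pow_pos (by linarith : 0 < θ) 2]

theorem mI_lt_div_mul_mI {p : ℝ} (hp1 : 1 < p) (hp3 : p < 3) {lam α : ℝ} (hα : 0 < α)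
    (hlt : α < lam) : mI p lam < lam / α * mI p α := by
  have hlt_self : mI p α < α := by
    obtain ⟨u, hu, hI⟩ := exists_Ifun_lt hp1 hp3 hα
    exact (csInf_le (bddBelow_Ifun hp1 hp3 α) ⟨u, hu, rfl⟩).trans_lt hI
  set θ := Real.sqrt (lam / α) with hθdef
  have hθ : 1 < θ := Real.lt_sqrt_of_sq_lt (by rw [one_pow, one_lt_div hα]; exact hlt)
  have hθ0 : 0 < θ := by linarith
  have hθ2 : θ ^ 2 = lam / α := Real.sq_sqrt (by have := hα.trans hlt; positivity)
  have hpow : θ ^ 2 < θ ^ (p + 1) := by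
    rw [← Real.rpow_natCast]
    exact Real.rpow_lt_rpow_of_exponent_lt hθ (by push_cast; linarith)
  have hθp : 0 < θ ^ (p + 1) := by positivity
  have hscale : (mI p lam + (θ ^ (p + 1) - θ ^ 2) * α) / θ ^ (p + 1) ≤ mI p α := by
    refine le_csInf ?_ ?_
    · obtain ⟨u, hu, -⟩ := exists_Ifun_lt hp1 hp3 hα
      exact ⟨_, u, hu, rfl⟩
    · rintro r ⟨u, hu, rfl⟩
      have hle : mI p lam ≤ Ifun p (θ • u : 𝓢(ℝ, ℝ)) := by
        refine csInf_le (bddBelow_Ifun hp1 hp3 lam) ⟨θ • u, ?_, rfl⟩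
        rw [integral_deriv_smul_sq, hu, hθ2]
        field_simp
      rw [Ifun_smul hθ0] at hle
      rw [div_le_iff₀ hθp, Ifun_eq]
      have hD : 0 ≤ ∫ x, (deriv (deriv u) x + u x) ^ 2 := integral_nonneg fun x => sq_nonneg _
      rw [hu] at hle ⊢
      nlinarith [mul_nonneg (sub_nonneg.2 hpow.le) hD]
  rw [div_le_iff₀ hθp] at hscale
  rw [← hθ2]
  nlinarith

/-- Strict scaling inequality, strict monotonicity of `λ ↦ m_I(λ)/λ`, and strict
sub-additivity of `m_I` for `1 < p < 3`. -/
theorem mI_strict_subadditive (p : ℝ) (hp1 : 1 < p) (hp3 : p < 3) :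
    (∀ lam α : ℝ, 0 < α → α < lam → mI p lam < (lam / α) * mI p α) ∧
    StrictAntiOn (fun lam : ℝ => mI p lam / lam) (Set.Ioi 0) ∧
    (∀ lam α : ℝ, 0 < α → α < lam → mI p lam < mI p α + mI p (lam - α)) := by
  have hscale : ∀ lam α : ℝ, 0 < α → α < lam → mI p lam < (lam / α) * mI p α :=
    fun lam α => mI_lt_div_mul_mI hp1 hp3
  have hanti : StrictAntiOn (fun lam : ℝ => mI p lam / lam) (Set.Ioi 0) := by
    intro α hα lam hlam hlt
    rw [Set.mem_Ioi] at hα hlam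
    have := hscale lam α hα hlt
    rw [div_lt_iff₀ hlam]
    calc mI p lam < lam / α * mI p α := this
      _ = mI p α / α * lam := by ring
  refine ⟨hscale, hanti, fun lam α hα hlt => ?_⟩
  have hlam := hα.trans hlt
  have hβ := sub_pos.2 hlt
  have h1 := hanti hα hlam hlt
  have h2 := hanti hβ hlam (sub_lt_self lam hα)
  simp only at h1 h2
  rw [lt_div_iff₀ hα] at h1
  rw [lt_div_iff₀ hβ] at h2
  calc mI p lam = mI p lam / lam * α + mI p lam / lam * (lam - α) := by field_simp; ring
    _ < mI p α + mI p (lam - α) := add_lt_add h1 h2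
end
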